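/- Let G be a 2n-vertex d-regular λ-bi-expander with λ > 0. Then for every vertex set A ⊆ V(G) with |A| ≤ n/4, the outer boundary ∂(A) = N(A) \ A satisfies |∂(A)| ≥ min{n/4, (d²/(4λ²) − 1)·|A|}. -/

import Mathlib

/-- Number of pairs (a,b) ∈ S × T with {a,b} an edge of G. -/
def edgeCount {V : Type*} (G : SimpleGraph V) [DecidableRel G.Adj]
    (S T : Finset V) : ℕ :=
  ((S ×ˢ T).filter (fun p => G.Adj p.1 p.2)).card

/-- `G` is a `d`-regular `λ`-bi-expander with `2n` vertices and color classes `V0`, `V1`. -/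
def IsBiExpander {V : Type*} [Fintype V] (G : SimpleGraph V) [DecidableRel G.Adj]
    (V0 V1 : Finset V) (n d : ℕ) (lam : ℝ) : Prop :=
  Fintype.card V = 2 * n ∧ V0.card = n ∧ V1.card = n ∧
  (∀ v : V, v ∈ V0 ∨ v ∈ V1) ∧ Disjoint V0 V1 ∧
  (∀ u v : V, G.Adj u v → (u ∈ V0 ∧ v ∈ V1) ∨ (u ∈ V1 ∧ v ∈ V0)) ∧
  (∀ v : V, G.degree v = d) ∧
  ∀ S T : Finset V, S ⊆ V0 → T ⊆ V1 →
    |(edgeCount G S T : ℝ) - (d : ℝ) / (n : ℝ) * S.card * T.card| ≤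
      lam * Real.sqrt ((S.card : ℝ) * T.card)

/-- Graph homomorphisms from `G` to `ℤ` vanishing at `v₀`. -/
def HomSet {V : Type*} (G : SimpleGraph V) (v₀ : V) : Set (V → ℤ) :=
  {f | f v₀ = 0 ∧ ∀ u v : V, G.Adj u v → |f u - f v| = 1}

/-- The neighborhood of a vertex set `A`. -/
def nbr {V : Type*} [Fintype V] (G : SimpleGraph V) [DecidableRel G.Adj]
    (A : Finset V) : Finset V :=
  Finset.univ.filter (fun b => ∃ a ∈ A, G.Adj a b)

theorem edgeCount_comm {V : Type*} (G : SimpleGraph V) [DecidableRel G.Adj]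
    (S T : Finset V) : edgeCount G S T = edgeCount G T S := by
  unfold edgeCount
  refine Finset.card_bij' (fun p _ => p.swap) (fun p _ => p.swap) ?_ ?_ ?_ ?_ <;>
    simp +contextual [G.adj_comm]

theorem edgeCount_nbr {V : Type*} [Fintype V] (G : SimpleGraph V) [DecidableRel G.Adj]
    {d : ℕ} (hd : ∀ v, G.degree v = d) (S : Finset V) :
    edgeCount G S (nbr G S) = d * S.card := by
  unfold edgeCount
  rw [Finset.card_filter, Finset.sum_product, mul_comm, ← smul_eq_mul]
  refine Finset.sum_eq_card_nsmul fun a ha => ?_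
  rw [← hd a, ← G.card_neighborFinset_eq_degree, ← Finset.card_filter]
  congr 1
  ext b
  simp only [nbr, Finset.mem_filter, Finset.mem_univ, true_and, SimpleGraph.mem_neighborFinset]
  exact ⟨fun h => h.2, fun h => ⟨⟨a, ha, h⟩, h⟩⟩

theorem nbr_mono {V : Type*} [Fintype V] (G : SimpleGraph V) [DecidableRel G.Adj]
    {S T : Finset V} (h : S ⊆ T) : nbr G S ⊆ nbr G T := by
  intro b hb
  simp only [nbr, Finset.mem_filter, Finset.mem_univ, true_and] at hb ⊢
  obtain ⟨a, ha, hab⟩ := hb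
  exact ⟨a, h ha, hab⟩

/-- A one-sided mixing bound between sets of sizes `s` and `t ≤ n / 2` spanning `d * s` edges
forces `t` to be large. -/
theorem expansion_of_mixing {d n lam s t : ℝ} (hd : 0 ≤ d) (hn : 0 ≤ n) (hlam : 0 < lam)
    (hs : 0 ≤ s) (ht : 0 ≤ t) (htn : t ≤ n / 2)
    (h : d * s - d / n * s * t ≤ lam * √(s * t)) :
    d ^ 2 / (4 * lam ^ 2) * s ≤ t := by
  have hfrac : t / n ≤ 1 / 2 := div_le_of_le_mul₀ hn (by norm_num) (by linarith)
  have hle : d / n * s * t ≤ d * s * (1 / 2) := by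
    rw [show d / n * s * t = d * s * (t / n) by ring]
    gcongr
  have hsq : (d * s / 2) ^ 2 ≤ (lam * √(s * t)) ^ 2 := by
    gcongr
    linarith
  rw [mul_pow, Real.sq_sqrt (by positivity)] at hsq
  rcases hs.eq_or_lt with rfl | hs
  · simpa using ht
  rw [div_mul_eq_mul_div, div_le_iff₀ (by positivity)]
  refine le_of_mul_le_mul_left ?_ hs
  linarith

theorem stmt16 {V : Type*} [Fintype V] [DecidableEq V] (G : SimpleGraph V) [DecidableRel G.Adj]
    (V0 V1 : Finset V) (n d : ℕ) (lam : ℝ) (hlam : 0 < lam)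
    (hG : IsBiExpander G V0 V1 n d lam) (A : Finset V)
    (hA : (A.card : ℝ) ≤ (n : ℝ) / 4) :
    min ((n : ℝ) / 4) (((d : ℝ) ^ 2 / (4 * lam ^ 2) - 1) * A.card) ≤
      (((nbr G A) \ A).card : ℝ) := by
  obtain ⟨-, -, -, hcov, hdisj, hadj, hdeg, hmix⟩ := hG
  have hd : (0 : ℝ) ≤ d := d.cast_nonneg
  have hn : (0 : ℝ) ≤ n := n.cast_nonneg
  have hN0 : nbr G (A ∩ V0) ⊆ V1 := by
    intro b hb
    simp only [nbr, Finset.mem_filter, Finset.mem_univ, true_and, Finset.mem_inter] at hb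
    obtain ⟨a, ⟨-, ha⟩, hab⟩ := hb
    exact (hadj a b hab).elim (·.2) fun h => (Finset.disjoint_left.mp hdisj ha h.1).elim
  have hN1 : nbr G (A ∩ V1) ⊆ V0 := by
    intro b hb
    simp only [nbr, Finset.mem_filter, Finset.mem_univ, true_and, Finset.mem_inter] at hb
    obtain ⟨a, ⟨-, ha⟩, hab⟩ := hb
    exact (hadj a b hab).elim (fun h => (Finset.disjoint_left.mp hdisj h.1 ha).elim) (·.2)
  have hmix0 := hmix (A ∩ V0) _ Finset.inter_subset_right hN0
  have hmix1 := hmix _ (A ∩ V1) hN1 Finset.inter_subset_right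
  rw [edgeCount_nbr G hdeg, Nat.cast_mul] at hmix0
  rw [edgeCount_comm, edgeCount_nbr G hdeg, Nat.cast_mul, mul_right_comm,
    mul_comm ((nbr G (A ∩ V1)).card : ℝ)] at hmix1
  have hexp0 := fun h => expansion_of_mixing hd hn hlam (Nat.cast_nonneg _) (Nat.cast_nonneg _) h
    ((le_abs_self _).trans hmix0)
  have hexp1 := fun h => expansion_of_mixing hd hn hlam (Nat.cast_nonneg _) (Nat.cast_nonneg _) h
    ((le_abs_self _).trans hmix1)
  have hcardA : A.card = (A ∩ V0).card + (A ∩ V1).card := by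
    rw [← Finset.card_union_of_disjoint
      (hdisj.mono Finset.inter_subset_right Finset.inter_subset_right),
      ← Finset.inter_union_distrib_left, Finset.inter_eq_left.mpr]
    exact fun v _ => Finset.mem_union.mpr (hcov v)
  have hcardN : (nbr G (A ∩ V0)).card + (nbr G (A ∩ V1)).card ≤ (nbr G A).card := by
    rw [← Finset.card_union_of_disjoint (hdisj.symm.mono hN0 hN1)]
    exact Finset.card_le_card (Finset.union_subset (nbr_mono G Finset.inter_subset_left)
      (nbr_mono G Finset.inter_subset_left))
  have hbd : (nbr G A).card ≤ (nbr G A \ A).card + A.card := by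
    have := Finset.le_card_sdiff A (nbr G A)
    omega
  have hcardA' : (A.card : ℝ) = (A ∩ V0).card + (A ∩ V1).card := mod_cast hcardA
  have hlower : ((nbr G (A ∩ V0)).card : ℝ) + (nbr G (A ∩ V1)).card ≤
      (nbr G A \ A).card + A.card := mod_cast hcardN.trans hbd
  have h0 : (0 : ℝ) ≤ (nbr G (A ∩ V0)).card := Nat.cast_nonneg _
  have h1 : (0 : ℝ) ≤ (nbr G (A ∩ V1)).card := Nat.cast_nonneg _
  rcases le_total ((nbr G (A ∩ V0)).card : ℝ) (n / 2) with ht0 | ht0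
  · rcases le_total ((nbr G (A ∩ V1)).card : ℝ) (n / 2) with ht1 | ht1
    · refine (min_le_right _ _).trans ?_
      have e0 := hexp0 ht0
      have e1 := hexp1 ht1
      rw [sub_mul, one_mul]
      nth_rewrite 1 [hcardA']
      rw [mul_add]
      linarith
    · exact (min_le_left _ _).trans (by linarith)
  · exact (min_le_left _ _).trans (by linarith)
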